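/- Let 0 < q < 1, x > 0 and μ > λ > 0. Then e^{(μ−λ)ψ_q(x+λ)} < Γ_q(x+μ)/Γ_q(x+λ) < e^{(μ−λ)ψ_q(x+μ)}. -/

import Mathlib

/-- The `q`-extension of the Gamma function: for fixed `q ∈ (0,1)` and `x > 0`,
`Γ_q(x) = (1-q)^{1-x} ∏_{n=0}^∞ (1-q^{n+1})/(1-q^{n+x})`. -/
noncomputable def qGamma (q x : ℝ) : ℝ :=
  (1 - q) ^ (1 - x) * ∏' n : ℕ, (1 - q ^ (n + 1)) / (1 - q ^ ((n : ℝ) + x))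

/-- The `q`-extension of the digamma function:
`ψ_q(x) = -ln(1-q) + (ln q) ∑_{n=1}^∞ q^{n x}/(1-q^n)`. -/
noncomputable def qDigamma (q x : ℝ) : ℝ :=
  -Real.log (1 - q) + Real.log q * ∑' n : ℕ, q ^ (((n : ℝ) + 1) * x) / (1 - q ^ (n + 1))

/-- For positive `x`, the values `q ^ (n + x)` lie in `(0, 1)`. -/
theorem qGamma_node_mem_Ioo {q x : ℝ} (hq0 : 0 < q) (hq1 : q < 1) (hx : 0 < x) (n : ℕ) :
    q ^ ((n : ℝ) + x) ∈ Set.Ioo (0 : ℝ) 1 :=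
  ⟨Real.rpow_pos_of_pos hq0 _, Real.rpow_lt_one hq0.le hq1 (by positivity)⟩

theorem summable_log_one_sub_rpow {q x : ℝ} (hq0 : 0 < q) (hq1 : q < 1) :
    Summable fun n : ℕ ↦ Real.log (1 - q ^ ((n : ℝ) + x)) := by
  have h : Summable fun n : ℕ ↦ -q ^ ((n : ℝ) + x) := by
    simpa only [Real.rpow_add hq0, Real.rpow_natCast] using
      ((summable_geometric_of_lt_one hq0.le hq1).mul_right (q ^ x)).neg
  simpa only [sub_eq_add_neg] using Real.summable_log_one_add_of_summable h

/-- Lambert-type expansion of the logarithm of the infinite product in `Γ_q`. -/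
theorem hasSum_log_one_sub_rpow {q x : ℝ} (hq0 : 0 < q) (hq1 : q < 1) (hx : 0 < x) :
    HasSum (fun k : ℕ ↦ q ^ (((k : ℝ) + 1) * x) / (((k : ℝ) + 1) * (1 - q ^ (k + 1))))
      (-∑' n : ℕ, Real.log (1 - q ^ ((n : ℝ) + x))) := by
  set f : ℕ × ℕ → ℝ := fun p ↦ (q ^ ((p.1 : ℝ) + x)) ^ (p.2 + 1) / ((p.2 : ℝ) + 1) with hf
  have hrow (n : ℕ) : HasSum (fun k ↦ f (n, k)) (-Real.log (1 - q ^ ((n : ℝ) + x))) := by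
    obtain ⟨h0, h1⟩ := qGamma_node_mem_Ioo hq0 hq1 hx n
    simpa only [hf] using Real.hasSum_pow_div_log_of_abs_lt_one
      (show |q ^ ((n : ℝ) + x)| < 1 by rwa [abs_of_pos h0])
  have hcol (k : ℕ) : HasSum (fun n ↦ f (n, k))
      (q ^ (((k : ℝ) + 1) * x) / (((k : ℝ) + 1) * (1 - q ^ (k + 1)))) := by
    have hk : q ^ (k + 1) < 1 := pow_lt_one₀ hq0.le hq1 k.succ_ne_zero
    have hgeo := (hasSum_geometric_of_lt_one (by positivity) hk).mul_right
      (q ^ (((k : ℝ) + 1) * x) / ((k : ℝ) + 1))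
    convert! hgeo using 1
    · funext n
      have hpow : (q ^ x) ^ (k + 1) = q ^ (((k : ℝ) + 1) * x) := by
        rw [← Real.rpow_natCast, ← Real.rpow_mul hq0.le]
        push_cast
        rw [mul_comm]
      simp only [hf]
      rw [Real.rpow_add hq0, Real.rpow_natCast, mul_pow, hpow, ← pow_mul, ← pow_mul, mul_comm n,
        mul_div_assoc]
    · have : 1 - q ^ (k + 1) ≠ 0 := (sub_pos.2 hk).ne'
      field_simp
  have hlog := (summable_log_one_sub_rpow (x := x) hq0 hq1).neg
  have hsum : Summable f := by
    refine (summable_prod_of_nonneg fun p ↦ ?_).2 ⟨fun n ↦ (hrow n).summable, ?_⟩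
    · have := (qGamma_node_mem_Ioo hq0 hq1 hx p.1).1
      simp only [hf, Pi.zero_apply]
      positivity
    · simpa only [(hrow _).tsum_eq] using hlog
  have htotal : ∑' p, f p = -∑' n : ℕ, Real.log (1 - q ^ ((n : ℝ) + x)) := by
    rw [← tsum_neg]
    exact (hsum.hasSum.prod_fiberwise hrow).unique hlog.hasSum
  rw [← htotal]
  exact ((Equiv.prodComm ℕ ℕ).hasSum_iff.2 hsum.hasSum).prod_fiberwise hcol

theorem qGamma_eq_exp {q x : ℝ} (hq0 : 0 < q) (hq1 : q < 1) (hx : 0 < x) :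
    qGamma q x = Real.exp ((1 - x) * Real.log (1 - q) +
      (∑' n : ℕ, Real.log (1 - q ^ ((n : ℝ) + 1)) -
        ∑' n : ℕ, Real.log (1 - q ^ ((n : ℝ) + x)))) := by
  have hpos {y : ℝ} (hy : 0 < y) (n : ℕ) : 0 < 1 - q ^ ((n : ℝ) + y) :=
    sub_pos.2 (qGamma_node_mem_Ioo hq0 hq1 hy n).2
  have hdiv (n : ℕ) : Real.log ((1 - q ^ ((n : ℝ) + 1)) / (1 - q ^ ((n : ℝ) + x))) =
      Real.log (1 - q ^ ((n : ℝ) + 1)) - Real.log (1 - q ^ ((n : ℝ) + x)) :=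
    Real.log_div (hpos one_pos n).ne' (hpos hx n).ne'
  have h1 := summable_log_one_sub_rpow (x := 1) hq0 hq1
  have h2 := summable_log_one_sub_rpow (x := x) hq0 hq1
  have hprod := Real.rexp_tsum_eq_tprod (fun n : ℕ ↦ div_pos (hpos one_pos n) (hpos hx n))
    (by simpa only [hdiv] using h1.sub h2)
  simp only [hdiv] at hprod
  rw [h1.tsum_sub h2] at hprod
  have hnat (n : ℕ) : q ^ (n + 1) = q ^ ((n : ℝ) + 1) := by
    rw [← Real.rpow_natCast]
    push_cast
    rfl
  rw [Real.exp_add, hprod, mul_comm (1 - x), ← Real.rpow_def_of_pos (sub_pos.2 hq1)]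
  simp only [qGamma, hnat]

/-- The series defining `ψ_q` converges. -/
theorem summable_qDigamma {q x : ℝ} (hq0 : 0 < q) (hq1 : q < 1) (hx : 0 < x) :
    Summable fun n : ℕ ↦ q ^ (((n : ℝ) + 1) * x) / (1 - q ^ (n + 1)) := by
  have hr : q ^ x < 1 := Real.rpow_lt_one hq0.le hq1 hx
  have hgeo := ((summable_geometric_of_lt_one (Real.rpow_pos_of_pos hq0 x).le hr).mul_right
    (q ^ x / (1 - q)))
  have hq (n : ℕ) : q ^ (n + 1) ≤ q := pow_le_of_le_one hq0.le hq1.le n.succ_ne_zero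
  refine hgeo.of_nonneg_of_le (fun n ↦ ?_) fun n ↦ ?_
  · exact div_nonneg (Real.rpow_pos_of_pos hq0 _).le (by linarith [hq n])
  · have hpow : q ^ (((n : ℝ) + 1) * x) = (q ^ x) ^ n * q ^ x := by
      rw [← pow_succ, ← Real.rpow_natCast, ← Real.rpow_mul hq0.le]
      push_cast
      rw [mul_comm]
    rw [hpow, ← mul_div_assoc]
    exact div_le_div_of_nonneg_left (by positivity) (by linarith) (by linarith [hq n])

theorem sub_mul_exp_lt_exp_sub_exp {u v : ℝ} (h : u ≠ v) :
    (u - v) * Real.exp v < Real.exp u - Real.exp v := by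
  have h1 := Real.add_one_lt_exp (sub_ne_zero.2 h)
  have h2 : Real.exp u = Real.exp (u - v) * Real.exp v := by
    rw [← Real.exp_add, sub_add_cancel]
  nlinarith [Real.exp_pos v]

/-- Tangent-line inequality for `t ↦ log Γ_q(t)` (strict convexity). -/
theorem exp_mul_qDigamma_lt_qGamma_div {q a b : ℝ} (hq0 : 0 < q) (hq1 : q < 1) (ha : 0 < a)
    (hb : 0 < b) (hab : a ≠ b) :
    Real.exp ((b - a) * qDigamma q a) < qGamma q b / qGamma q a := by
  rw [qGamma_eq_exp hq0 hq1 ha, qGamma_eq_exp hq0 hq1 hb, ← Real.exp_sub, Real.exp_lt_exp]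
  have hψ := (summable_qDigamma hq0 hq1 ha).hasSum.mul_left ((b - a) * Real.log q)
  have hΓ := (hasSum_log_one_sub_rpow hq0 hq1 hb).sub (hasSum_log_one_sub_rpow hq0 hq1 ha)
  have hlt (k : ℕ) : (b - a) * Real.log q * (q ^ (((k : ℝ) + 1) * a) / (1 - q ^ (k + 1))) <
      q ^ (((k : ℝ) + 1) * b) / (((k : ℝ) + 1) * (1 - q ^ (k + 1))) -
        q ^ (((k : ℝ) + 1) * a) / (((k : ℝ) + 1) * (1 - q ^ (k + 1))) := by
    have hk : (0 : ℝ) < (k : ℝ) + 1 := by positivity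
    have hden : 0 < 1 - q ^ (k + 1) := sub_pos.2 (pow_lt_one₀ hq0.le hq1 k.succ_ne_zero)
    have hne : Real.log q * (((k : ℝ) + 1) * b) ≠ Real.log q * (((k : ℝ) + 1) * a) := fun h ↦
      hab.symm (mul_left_cancel₀ hk.ne' (mul_left_cancel₀ (Real.log_neg hq0 hq1).ne h))
    have hexp := sub_mul_exp_lt_exp_sub_exp hne
    rw [← Real.rpow_def_of_pos hq0, ← Real.rpow_def_of_pos hq0] at hexp
    rw [← sub_div, lt_div_iff₀ (by positivity)]
    refine lt_of_eq_of_lt ?_ hexp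
    field_simp
  have hmain := hasSum_lt (fun k ↦ (hlt k).le) (hlt 0) hψ hΓ
  rw [qDigamma]
  linarith

theorem qGamma_ratio_exp_bounds_shift (q x μ lam : ℝ) (hq0 : 0 < q) (hq1 : q < 1)
    (hx : 0 < x) (hlam : 0 < lam) (hμlam : lam < μ) :
    Real.exp ((μ - lam) * qDigamma q (x + lam)) < qGamma q (x + μ) / qGamma q (x + lam) ∧
    qGamma q (x + μ) / qGamma q (x + lam) < Real.exp ((μ - lam) * qDigamma q (x + μ)) := by
  have ha : 0 < x + lam := by linarith
  have hb : 0 < x + μ := by linarith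
  have hab : x + lam ≠ x + μ := by linarith
  constructor
  · simpa using exp_mul_qDigamma_lt_qGamma_div hq0 hq1 ha hb hab
  · have h := exp_mul_qDigamma_lt_qGamma_div hq0 hq1 hb ha hab.symm
    have h' := inv_strictAnti₀ (Real.exp_pos _) h
    rwa [inv_div, ← Real.exp_neg, ← neg_mul, neg_sub, add_sub_add_left_eq_sub] at h'
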